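/- Let G and H be *-antimonotone and premotive games over a poset A. Then G ◁ H if and only if G ≤ H+*. -/

import Mathlib

/-- Games over a poset `α`: atomic games `[a]` for `a : α`, and composite games
`⟨L|R⟩` given by nonempty families of left and right options. -/
inductive Game (α : Type) : Type 1 where
  | atom : α → Game α
  | comp : (ι κ : Type) → (ι → Game α) → (κ → Game α) → Nonempty ι → Nonempty κ → Game α

namespace Game

variable {α β : Type}

/-- `G'` is a left option of the game. -/
def IsLeftOption (G' : Game α) : Game α → Prop
  | atom _ => False
  | comp _ _ L _ _ _ => ∃ i, L i = G'

/-- `G'` is a right option of the game. -/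
def IsRightOption (G' : Game α) : Game α → Prop
  | atom _ => False
  | comp _ _ _ R _ _ => ∃ k, R k = G'

/-- `G'` is an option of `G`. -/
def IsOption (G' G : Game α) : Prop := IsLeftOption G' G ∨ IsRightOption G' G

/-- A game is composite if it is not atomic. -/
def IsComposite : Game α → Prop
  | atom _ => False
  | comp _ _ _ _ _ _ => True

/-- `G'` is a follower of `G`: `G` itself, an option of `G`, or recursively a follower
of an option of `G`. -/
def IsFollower (G' G : Game α) : Prop := Relation.ReflTransGen IsOption G' G

/-- The dual game: Left and Right switch sides; it is a game over the opposite poset. -/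
def dual : Game α → Game αᵒᵈ
  | atom a => atom (OrderDual.toDual a)
  | comp ι κ L R hι hκ => comp κ ι (fun k => (R k).dual) (fun i => (L i).dual) hκ hι

/-- The image of a game under a (monotone) function applied to atoms. -/
def map (f : α → β) : Game α → Game β
  | atom a => atom (f a)
  | comp ι κ L R hι hκ => comp ι κ (fun i => (L i).map f) (fun k => (R k).map f) hι hκ

/-- The (disjunctive) sum of a game over `α` and a game over `β`, a game over `α × β`. -/
noncomputable def add : Game α → Game β → Game (α × β) := by
  intro G
  induction G with
  | atom g =>
    intro H
    induction H with
    | atom h => exact atom (g, h)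
    | comp ι κ L R hι hκ IHL IHR => exact comp ι κ IHL IHR hι hκ
  | comp ι κ L R hι hκ IHL IHR =>
    intro H
    induction H with
    | atom h => exact comp ι κ (fun i => IHL i (atom h)) (fun k => IHR k (atom h)) hι hκ
    | comp ι' κ' L' R' hι' hκ' IHL' IHR' =>
      exact comp (ι ⊕ ι') (κ ⊕ κ')
        (Sum.elim (fun i => IHL i (comp ι' κ' L' R' hι' hκ')) IHL')
        (Sum.elim (fun k => IHR k (comp ι' κ' L' R' hι' hκ')) IHR')
        (hι.elim fun i => ⟨Sum.inl i⟩) (hκ.elim fun k => ⟨Sum.inl k⟩)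

mutual
/-- Left has a first player winning strategy in a game over the boolean poset:
either the game is the atom `⊤`, or some left option has a second player
winning strategy for Left. -/
inductive LeftWinsFirst : Game Bool → Prop where
  | atom_top : LeftWinsFirst (atom true)
  | move {G G' : Game Bool} : IsLeftOption G' G → LeftWinsSecond G' → LeftWinsFirst G

/-- Left has a second player winning strategy in a game over the boolean poset:
every right option has a first player winning strategy for Left, and if the game
is atomic it is the atom `⊤`. -/
inductive LeftWinsSecond : Game Bool → Prop where
  | mk {G : Game Bool} : (∀ G', IsRightOption G' G → LeftWinsFirst G') →
      (∀ b, G = atom b → b = true) → LeftWinsSecond G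
end

mutual
/-- A game is even if all of its options are odd (atomic games are even). -/
inductive Even {α : Type} : Game α → Prop where
  | mk {G : Game α} : (∀ G', IsOption G' G → Odd G') → Even G

/-- A game is odd if it is composite and all of its options are even. -/
inductive Odd {α : Type} : Game α → Prop where
  | mk {G : Game α} : G.IsComposite → (∀ G', IsOption G' G → Even G') → Odd G
end

/-- A game has parity if it is even or odd. -/
def HasParity (G : Game α) : Prop := Even G ∨ Odd G

/-- `G` and `H` have matching parity (both even or both odd). -/
def MatchingParity (G H : Game α) : Prop := (Even G ∧ Even H) ∨ (Odd G ∧ Odd H)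

/-- `G` and `H` have mismatching parity (one even, the other odd). -/
def MismatchParity (G H : Game α) : Prop := (Even G ∧ Odd H) ∨ (Odd G ∧ Even H)

mutual
/-- The intrinsic order `G ≤ H` on games over a poset: every left option `G^L` of `G`
satisfies `G^L ◁ H`, every right option `H^R` of `H` satisfies `G ◁ H^R`, and if
both games are atoms `[g]`, `[h]` then `g ≤ h`. -/
inductive Le {α : Type} [PartialOrder α] : Game α → Game α → Prop where
  | mk {G H : Game α} :
      (∀ G', IsLeftOption G' G → Tri G' H) →
      (∀ H', IsRightOption H' H → Tri G H') →
      (∀ g h, G = atom g → H = atom h → g ≤ h) →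
      Le G H

/-- The intrinsic relation `G ◁ H` on games over a poset: some right option `G^R` of `G`
satisfies `G^R ≤ H`, or some left option `H^L` of `H` satisfies `G ≤ H^L`. -/
inductive Tri {α : Type} [PartialOrder α] : Game α → Game α → Prop where
  | inr {G H G' : Game α} : IsRightOption G' G → Le G' H → Tri G H
  | inl {G H H' : Game α} : IsLeftOption H' H → Le G H' → Tri G H
end

/-- The comparison game `λ(Gᵒᵖ + H)`, a game over the boolean poset, where
`λ : αᵒᵈ × α → 𝔹` is the monotone map with `λ(xᵒᵖ, y) = ⊤` iff `x ≤ y`. -/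
noncomputable def comparison [PartialOrder α] (G H : Game α) : Game Bool :=
  map (fun p : αᵒᵈ × α => @decide (OrderDual.ofDual p.1 ≤ p.2) (Classical.propDecidable _))
    (G.dual.add H)

/-- A game is locally premotive if Left has a first player winning strategy in
the comparison game `λ(Gᵒᵖ + G)`. -/
def LocallyPremotive [PartialOrder α] (G : Game α) : Prop := LeftWinsFirst (comparison G G)

/-- A game is premotive if it and all of its followers are locally premotive. -/
def Premotive [PartialOrder α] (G : Game α) : Prop :=
  ∀ G', IsFollower G' G → LocallyPremotive G'

/-- The game `* = ⟨0|0⟩` over the one-element poset. -/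
def star : Game Unit := comp Unit Unit (fun _ => atom ()) (fun _ => atom ()) ⟨()⟩ ⟨()⟩

/-- `G + *`, identified with a game over `α` via the isomorphism `α × 1 ≅ α`. -/
noncomputable def addStar (G : Game α) : Game α := map Prod.fst (G.add star)

/-- A game is locally `*`-antimonotone if `G^L + * ≤ G ≤ G^R + *` for all left and
right options `G^L`, `G^R`. -/
def LocallyStarAnti [PartialOrder α] (G : Game α) : Prop :=
  (∀ G', IsLeftOption G' G → Le G'.addStar G) ∧ (∀ G', IsRightOption G' G → Le G G'.addStar)

/-- A game is `*`-antimonotone if it and all of its followers are locally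
`*`-antimonotone. -/
def StarAnti [PartialOrder α] (G : Game α) : Prop :=
  ∀ G', IsFollower G' G → LocallyStarAnti G'

/-- `ε(G + X)`: the game `G` over `α` embedded in a context `X`, a game over the poset
`[α, 𝔹]` of monotone functions `α → 𝔹`, via the application map `ε(a, f) = f a`. -/
noncomputable def ctxSum [PartialOrder α] (G : Game α) (X : Game (α →o Bool)) : Game Bool :=
  map (fun p : α × (α →o Bool) => p.2 p.1) (G.add X)

/-- The outcome `(o_L(G), o_R(G)) ∈ 𝔹 × 𝔹` of a game over the boolean poset:
`o_L(G) = ⊤` iff Left has a first player winning strategy and `o_R(G) = ⊤` iff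
Left has a second player winning strategy. -/
noncomputable def outcome (G : Game Bool) : Bool × Bool :=
  (@decide (LeftWinsFirst G) (Classical.propDecidable _),
   @decide (LeftWinsSecond G) (Classical.propDecidable _))

/-- The contextual order `G ≤_c H`: `o(G+X) ≤ o(H+X)` for every context `X`. -/
def ContextualLe [PartialOrder α] (G H : Game α) : Prop :=
  ∀ X : Game (α →o Bool), outcome (ctxSum G X) ≤ outcome (ctxSum H X)

/-- The contextual relation `G ◁_c H`: `o_R(G+X) ≤ o_L(H+X)` for every context `X`. -/
def ContextualTri [PartialOrder α] (G H : Game α) : Prop :=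
  ∀ X : Game (α →o Bool), (outcome (ctxSum G X)).2 ≤ (outcome (ctxSum H X)).1

/-- Two games are identical when they are equal as set-based games: both are the same
atom, or both are composite with identical sets of left options and identical sets of
right options (recursively). -/
def Identical : Game α → Game α → Prop
  | atom a, atom b => a = b
  | comp _ _ L R _ _, comp _ _ L' R' _ _ =>
      ((∀ i, ∃ i', Identical (L i) (L' i')) ∧ (∀ i', ∃ i, Identical (L i) (L' i'))) ∧
      ((∀ k, ∃ k', Identical (R k) (R' k')) ∧ (∀ k', ∃ k, Identical (R k) (R' k')))
  | _, _ => False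

theorem optInd {P : Game α → Prop} (h : ∀ G, (∀ G', IsOption G' G → P G') → P G) :
    ∀ G, P G := by
  intro G
  induction G with
  | atom a =>
    apply h
    rintro G' (h1 | h1) <;> exact h1.elim
  | comp ι κ L R hι hκ IHL IHR =>
    apply h
    rintro G' (⟨i, rfl⟩ | ⟨k, rfl⟩)
    · exact IHL i
    · exact IHR k

theorem map_add_zero (G : Game α) : map Prod.fst (G.add (atom ())) = G := by
  induction G with
  | atom a => rfl
  | comp ι κ L R hι hκ IHL IHR =>
    have h1 : (fun i => map Prod.fst ((L i).add (atom ()))) = L := funext IHL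
    have h2 : (fun i => map Prod.fst ((R i).add (atom ()))) = R := funext IHR
    change comp ι κ (fun i => map Prod.fst ((L i).add (atom ())))
      (fun i => map Prod.fst ((R i).add (atom ()))) hι hκ = _
    rw [h1, h2]

theorem left_addStar (X G : Game α) : IsLeftOption X (addStar G) ↔
    X = G ∨ ∃ G', IsLeftOption G' G ∧ X = addStar G' := by
  cases G with
  | atom a =>
    constructor
    · rintro ⟨i, rfl⟩
      exact Or.inl rfl
    · rintro (rfl | ⟨G', h, _⟩)
      · exact ⟨(), rfl⟩
      · exact h.elim
  | comp ι κ L R hι hκ =>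
    constructor
    · rintro ⟨i | i, rfl⟩
      · exact Or.inr ⟨L i, ⟨i, rfl⟩, rfl⟩
      · exact Or.inl (map_add_zero (comp ι κ L R hι hκ))
    · rintro (rfl | ⟨G', ⟨i, rfl⟩, rfl⟩)
      · exact ⟨Sum.inr (), map_add_zero (comp ι κ L R hι hκ)⟩
      · exact ⟨Sum.inl i, rfl⟩

theorem right_addStar (X G : Game α) : IsRightOption X (addStar G) ↔
    X = G ∨ ∃ G', IsRightOption G' G ∧ X = addStar G' := by
  cases G with
  | atom a =>
    constructor
    · rintro ⟨i, rfl⟩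
      exact Or.inl rfl
    · rintro (rfl | ⟨G', h, _⟩)
      · exact ⟨(), rfl⟩
      · exact h.elim
  | comp ι κ L R hι hκ =>
    constructor
    · rintro ⟨i | i, rfl⟩
      · exact Or.inr ⟨R i, ⟨i, rfl⟩, rfl⟩
      · exact Or.inl (map_add_zero (comp ι κ L R hι hκ))
    · rintro (rfl | ⟨G', ⟨i, rfl⟩, rfl⟩)
      · exact ⟨Sum.inr (), map_add_zero (comp ι κ L R hι hκ)⟩
      · exact ⟨Sum.inl i, rfl⟩

theorem addStar_ne_atom (G : Game α) (a : α) : addStar G ≠ atom a := by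
  intro h
  have h1 : IsLeftOption G (addStar G) := (left_addStar G G).2 (Or.inl rfl)
  rw [h] at h1
  exact h1

mutual
/-- Weak order: Left wins the comparison game moving second. -/
inductive LeW {α : Type} [PartialOrder α] : Game α → Game α → Prop where
  | mk {G H : Game α} :
      (∀ G', IsLeftOption G' G → TriW G' H) →
      (∀ H', IsRightOption H' H → TriW G H') →
      (∀ g h, G = atom g → H = atom h → g ≤ h) →
      LeW G H

/-- Weak relation: Left wins the comparison game moving first. -/
inductive TriW {α : Type} [PartialOrder α] : Game α → Game α → Prop where
  | atom {g h : α} : g ≤ h → TriW (atom g) (atom h)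
  | inr {G H G' : Game α} : IsRightOption G' G → LeW G' H → TriW G H
  | inl {G H H' : Game α} : IsLeftOption H' H → LeW G H' → TriW G H
end

theorem left_comparison [PartialOrder α] (X G H : Game α) (Y : Game Bool)
    (h : IsLeftOption Y (comparison G H)) :
    (∃ G', IsRightOption G' G ∧ Y = comparison G' H) ∨
    (∃ H', IsLeftOption H' H ∧ Y = comparison G H') := by
  cases G with
  | atom g =>
    cases H with
    | atom k => exact h.elim
    | comp ι κ L R hι hκ =>
      obtain ⟨i, rfl⟩ := h
      exact Or.inr ⟨L i, ⟨i, rfl⟩, rfl⟩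
  | comp ι κ L R hι hκ =>
    cases H with
    | atom k =>
      obtain ⟨i, rfl⟩ := h
      exact Or.inl ⟨R i, ⟨i, rfl⟩, rfl⟩
    | comp ι' κ' L' R' hι' hκ' =>
      obtain ⟨i | i, rfl⟩ := h
      · exact Or.inl ⟨R i, ⟨i, rfl⟩, rfl⟩
      · exact Or.inr ⟨L' i, ⟨i, rfl⟩, rfl⟩

theorem right_comparison1 [PartialOrder α] (G H G' : Game α) (h : IsLeftOption G' G) :
    IsRightOption (comparison G' H) (comparison G H) := by
  cases G with
  | atom g => exact h.elim
  | comp ι κ L R hι hκ =>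
    obtain ⟨i, rfl⟩ := h
    cases H with
    | atom k => exact ⟨i, rfl⟩
    | comp ι' κ' L' R' hι' hκ' => exact ⟨Sum.inl i, rfl⟩

theorem right_comparison2 [PartialOrder α] (G H H' : Game α) (h : IsRightOption H' H) :
    IsRightOption (comparison G H') (comparison G H) := by
  cases H with
  | atom g => exact h.elim
  | comp ι κ L R hι hκ =>
    obtain ⟨i, rfl⟩ := h
    cases G with
    | atom k => exact ⟨i, rfl⟩
    | comp ι' κ' L' R' hι' hκ' => exact ⟨Sum.inr i, rfl⟩

theorem comparison_atom [PartialOrder α] (G H : Game α) (b : Bool)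
    (h : comparison G H = atom b) :
    ∃ g k, G = atom g ∧ H = atom k ∧ (b = true → g ≤ k) := by
  cases G with
  | atom g =>
    cases H with
    | atom k =>
      refine ⟨g, k, rfl, rfl, ?_⟩
      rintro rfl
      have h2 := Game.atom.inj h
      exact @of_decide_eq_true _ (Classical.propDecidable _) h2
    | comp ι κ L R hι hκ => cases h
  | comp ι κ L R hι hκ =>
    cases H with
    | atom k => cases h
    | comp ι' κ' L' R' hι' hκ' => cases h

theorem weak_of_wins [PartialOrder α] : ∀ G H : Game α,
    (LeftWinsFirst (comparison G H) → TriW G H) ∧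
    (LeftWinsSecond (comparison G H) → LeW G H) := by
  intro G
  induction G using optInd with
  | h G ihG =>
  intro H
  induction H using optInd with
  | h H ihH =>
  constructor
  · intro h
    generalize hX : comparison G H = X at h
    cases h with
    | atom_top =>
      obtain ⟨g, k, rfl, rfl, hgk⟩ := comparison_atom _ _ _ hX
      exact .atom (hgk rfl)
    | move h1 h2 =>
      subst hX
      rcases left_comparison G G H _ h1 with ⟨G', hG, rfl⟩ | ⟨H', hH, rfl⟩
      · exact .inr hG ((ihG _ (Or.inr hG) H).2 h2)
      · exact .inl hH ((ihH _ (Or.inl hH)).2 h2)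
  · rintro ⟨h1, h2⟩
    refine .mk ?_ ?_ ?_
    · intro G' hG
      exact (ihG _ (Or.inl hG) H).1 (h1 _ (right_comparison1 _ _ _ hG))
    · intro H' hH
      exact (ihH _ (Or.inr hH)).1 (h1 _ (right_comparison2 _ _ _ hH))
    · rintro g k rfl rfl
      exact @of_decide_eq_true _ (Classical.propDecidable _) (h2 _ rfl)

/-- Hereditary weak self-comparison. -/
def PM [PartialOrder α] (G : Game α) : Prop := ∀ G', IsFollower G' G → TriW G' G'

theorem PM.opt [PartialOrder α] {G G' : Game α} (h : PM G) (ho : IsOption G' G) : PM G' :=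
  fun X hX => h X (hX.tail ho)

theorem PM.of_opt [PartialOrder α] {G : Game α} (h : TriW G G)
    (ho : ∀ G', IsOption G' G → PM G') : PM G := by
  intro X hX
  rcases Relation.ReflTransGen.cases_tail hX with rfl | ⟨Y, h1, h2⟩
  · exact h
  · exact ho _ h2 _ h1

theorem Premotive.pm [PartialOrder α] {G : Game α} (h : Premotive G) : PM G :=
  fun X hX => (weak_of_wins X X).1 (h X hX)

theorem addStar_weak [PartialOrder α] : ∀ G H : Game α,
    (TriW G H → TriW (addStar G) (addStar H)) ∧
    (LeW G H → LeW (addStar G) (addStar H)) := by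
  intro G
  induction G using optInd with
  | h G ihG =>
  intro H
  induction H using optInd with
  | h H ihH =>
  constructor
  · intro h
    cases h with
    | @atom g k h =>
      refine .inr ((right_addStar (atom g) (atom g)).2 (Or.inl rfl)) (.mk ?_ ?_ ?_)
      · intro _ h; exact h.elim
      · intro X hX
        rcases (right_addStar _ _).1 hX with rfl | ⟨_, h, _⟩
        · exact .atom h
        · exact h.elim
      · intro a b _ h3; exact (addStar_ne_atom _ _ h3).elim
    | inr h1 h2 =>
      exact .inr ((right_addStar _ _).2 (Or.inr ⟨_, h1, rfl⟩)) ((ihG _ (Or.inr h1) H).2 h2)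
    | inl h1 h2 =>
      exact .inl ((left_addStar _ _).2 (Or.inr ⟨_, h1, rfl⟩)) ((ihH _ (Or.inl h1)).2 h2)
  · intro hle
    obtain ⟨h1, h2, h3⟩ := id hle
    refine .mk ?_ ?_ ?_
    · intro X hX
      rcases (left_addStar _ _).1 hX with rfl | ⟨G', hG, rfl⟩
      · exact .inl ((left_addStar _ _).2 (Or.inl rfl)) hle
      · exact (ihG _ (Or.inl hG) H).1 (h1 _ hG)
    · intro X hX
      rcases (right_addStar _ _).1 hX with rfl | ⟨H', hH, rfl⟩
      · exact .inr ((right_addStar _ _).2 (Or.inl rfl)) hle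
      · exact (ihH _ (Or.inr hH)).1 (h2 _ hH)
    · intro a b h3; exact (addStar_ne_atom _ _ h3).elim

theorem addStar_mono [PartialOrder α] : ∀ G H : Game α,
    (Tri G H → Tri (addStar G) (addStar H)) ∧
    (Le G H → Le (addStar G) (addStar H)) := by
  intro G
  induction G using optInd with
  | h G ihG =>
  intro H
  induction H using optInd with
  | h H ihH =>
  constructor
  · intro h
    cases h with
    | inr h1 h2 =>
      exact .inr ((right_addStar _ _).2 (Or.inr ⟨_, h1, rfl⟩)) ((ihG _ (Or.inr h1) H).2 h2)
    | inl h1 h2 =>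
      exact .inl ((left_addStar _ _).2 (Or.inr ⟨_, h1, rfl⟩)) ((ihH _ (Or.inl h1)).2 h2)
  · intro hle
    obtain ⟨h1, h2, h3⟩ := id hle
    refine .mk ?_ ?_ ?_
    · intro X hX
      rcases (left_addStar _ _).1 hX with rfl | ⟨G', hG, rfl⟩
      · exact .inl ((left_addStar _ _).2 (Or.inl rfl)) hle
      · exact (ihG _ (Or.inl hG) H).1 (h1 _ hG)
    · intro X hX
      rcases (right_addStar _ _).1 hX with rfl | ⟨H', hH, rfl⟩
      · exact .inr ((right_addStar _ _).2 (Or.inl rfl)) hle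
      · exact (ihH _ (Or.inr hH)).1 (h2 _ hH)
    · intro a b h3; exact (addStar_ne_atom _ _ h3).elim

theorem PM.addStar [PartialOrder α] {G : Game α} (h : PM G) : PM (addStar G) := by
  induction G using optInd with
  | h G ih =>
  refine PM.of_opt ((addStar_weak G G).1 (h G .refl)) ?_
  rintro X (hX | hX)
  · rcases (left_addStar _ _).1 hX with rfl | ⟨G', hG, rfl⟩
    · exact h
    · exact ih _ (Or.inl hG) (h.opt (Or.inl hG))
  · rcases (right_addStar _ _).1 hX with rfl | ⟨G', hG, rfl⟩
    · exact h
    · exact ih _ (Or.inr hG) (h.opt (Or.inr hG))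

theorem Le.refl' [PartialOrder α] (G : Game α) : Le G G := by
  induction G using optInd with
  | h G ih =>
  refine .mk (fun X hX => .inl hX (ih _ (Or.inl hX))) (fun X hX => .inr hX (ih _ (Or.inr hX))) ?_
  rintro g k rfl h
  exact (Game.atom.inj h).le

theorem le_addStar_addStar [PartialOrder α] (G : Game α) :
    Le G (Game.addStar (Game.addStar G)) := by
  induction G using optInd with
  | h G ih =>
  have hs : Tri G (Game.addStar G) := .inl ((left_addStar _ _).2 (Or.inl rfl)) (Le.refl' G)
  refine .mk (fun X hX => .inl ((left_addStar _ _).2 (Or.inr ⟨_,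
    (left_addStar _ _).2 (Or.inr ⟨_, hX, rfl⟩), rfl⟩)) (ih _ (Or.inl hX))) ?_ ?_
  · intro X hX
    rcases (right_addStar _ _).1 hX with rfl | ⟨Y, hY, rfl⟩
    · exact hs
    · rcases (right_addStar _ _).1 hY with rfl | ⟨Z, hZ, rfl⟩
      · exact hs
      · exact .inr hZ (ih _ (Or.inr hZ))
  · intro a b _ h; exact (addStar_ne_atom _ _ h).elim

theorem atom_tri [PartialOrder α] {g : α} {X : Game α} (h : Tri (atom g) X) :
    ∃ X', IsLeftOption X' X ∧ Le (atom g) X' := by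
  cases h with
  | inr h _ => exact h.elim
  | inl h h' => exact ⟨_, h, h'⟩

theorem tri_atom [PartialOrder α] {g : α} {X : Game α} (h : Tri X (atom g)) :
    ∃ X', IsRightOption X' X ∧ Le X' (atom g) := by
  cases h with
  | inl h _ => exact h.elim
  | inr h h' => exact ⟨_, h, h'⟩

theorem sandwich [PartialOrder α] (g k : α) : ∀ X Y : Game α,
    (TriW X Y → Le (atom g) X → Le Y (atom k) → g ≤ k) ∧
    (LeW X Y → Tri (atom g) X → Le Y (atom k) → g ≤ k) ∧
    (LeW X Y → Le (atom g) X → Tri Y (atom k) → g ≤ k) := by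
  intro X
  induction X using optInd with
  | h X ihX =>
  intro Y
  induction Y using optInd with
  | h Y ihY =>
  refine ⟨?_, ?_, ?_⟩
  · intro h hX hY
    cases h with
    | atom h =>
      obtain ⟨_, _, h1⟩ := hX
      obtain ⟨_, _, h2⟩ := hY
      exact (h1 _ _ rfl rfl).trans (h.trans (h2 _ _ rfl rfl))
    | inr h1 h2 =>
      obtain ⟨_, h3, _⟩ := hX
      exact (ihX _ (Or.inr h1) Y).2.1 h2 (h3 _ h1) hY
    | inl h1 h2 =>
      obtain ⟨h3, _, _⟩ := hY
      exact (ihY _ (Or.inl h1)).2.2 h2 hX (h3 _ h1)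
  · rintro ⟨h1, _, _⟩ hX hY
    obtain ⟨X', hX', hle⟩ := atom_tri hX
    exact (ihX _ (Or.inl hX') Y).1 (h1 _ hX') hle hY
  · rintro ⟨_, h1, _⟩ hX hY
    obtain ⟨Y', hY', hle⟩ := tri_atom hY
    exact (ihY _ (Or.inr hY')).1 (h1 _ hY') hX hle

theorem transAll [PartialOrder α] : ∀ A B C : Game α, PM B →
    (Le A B → Le B C → Le A C) ∧ (Tri A B → Le B C → Tri A C) ∧
    (Le A B → Tri B C → Tri A C) := by
  intro A
  induction A using optInd with
  | h A ihA =>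
  intro B
  induction B using optInd with
  | h B ihB =>
  intro C
  induction C using optInd with
  | h C ihC =>
  intro hB
  refine ⟨?_, ?_, ?_⟩
  · intro h1 h2
    obtain ⟨a1, a2, a3⟩ := id h1
    obtain ⟨b1, b2, b3⟩ := id h2
    refine .mk (fun X hX => (ihA _ (Or.inl hX) B C hB).2.1 (a1 _ hX) h2)
      (fun X hX => (ihC _ (Or.inr hX) hB).2.2 h1 (b2 _ hX)) ?_
    rintro g k rfl rfl
    exact (sandwich g k B B).1 (hB B .refl) h1 h2
  · intro h1 h2
    cases h1 with
    | inr h3 h4 => exact .inr h3 ((ihA _ (Or.inr h3) B C hB).1 h4 h2)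
    | inl h3 h4 =>
      obtain ⟨b1, b2, b3⟩ := h2
      exact (ihB _ (Or.inl h3) C (hB.opt (Or.inl h3))).2.2 h4 (b1 _ h3)
  · intro h1 h2
    cases h2 with
    | inr h3 h4 =>
      obtain ⟨b1, b2, b3⟩ := h1
      exact (ihB _ (Or.inr h3) C (hB.opt (Or.inr h3))).2.1 (b2 _ h3) h4
    | inl h3 h4 => exact .inl h3 ((ihC _ (Or.inl h3) hB).1 h1 h4)

/-- For `*`-antimonotone and premotive games, `G ◁ H` iff `G ≤ H + *`. -/
theorem tri_iff_le_addStar {α : Type} [PartialOrder α] (G H : Game α)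
    (hGs : StarAnti G) (hGp : Premotive G) (hHs : StarAnti H) (hHp : Premotive H) :
    Tri G H ↔ Le G (addStar H) := by
  constructor
  · intro h
    cases h with
    | @inr _ _ G' h1 h2 =>
      exact (transAll _ _ _ (hGp.pm.opt (Or.inr h1)).addStar).1 ((hGs G .refl).2 _ h1)
        ((addStar_mono _ _).2 h2)
    | @inl _ _ H' h1 h2 =>
      have hp : PM H' := hHp.pm.opt (Or.inl h1)
      have h3 := (addStar_mono _ _).2 ((hHs H .refl).1 _ h1)
      exact (transAll _ _ _ hp).1 h2
        ((transAll _ _ _ hp.addStar.addStar).1 (le_addStar_addStar H') h3)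
  · rintro ⟨_, h, _⟩
    exact h _ ((right_addStar _ _).2 (Or.inl rfl))

end Game
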